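/- arXiv:1806.05319 — 2 statements merged into one kernel-verified Lean document; each statement's English description precedes it below -/
import Mathlib

section
/- For every μ > 0 and every a₀ > 0 there exist constants M > 0 and ω > 0 (depending only on μ and a₀) such that for every α ≥ a₀, every mode solution u (with parameters μ, α), and every t ≥ 0, one has α·u(t)² + u'(t)² ≤ M·e^{−ωt}·(α·u(0)² + u'(0)²). -/
open MeasureTheory Set

/-- A *mode solution* with parameters `μ`, `α`: a twice continuously differentiable
function `u : [0,∞) → ℝ` satisfying `μ·u'' + u' + α·u = 0` on `[0,∞)`. -/
def IsModeSolution (μ α : ℝ) (u u' u'' : ℝ → ℝ) : Prop :=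
  (∀ t ∈ Set.Ici (0:ℝ), HasDerivWithinAt u (u' t) (Set.Ici 0) t) ∧
  (∀ t ∈ Set.Ici (0:ℝ), HasDerivWithinAt u' (u'' t) (Set.Ici 0) t) ∧
  ContinuousOn u'' (Set.Ici 0) ∧
  (∀ t ∈ Set.Ici (0:ℝ), μ * u'' t + u' t + α * u t = 0)

/-- A modified energy for the damped oscillator, equivalent to `α u² + v²` uniformly in `α ≥ a₀`. -/
noncomputable def modeLyapunov (μ α x v : ℝ) : ℝ :=
  μ * v ^ 2 + α * x ^ 2 + x * v + x ^ 2 / (2 * μ)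

lemma energy_le_modeLyapunov {μ α : ℝ} (hμ : 0 < μ) (hα : 0 ≤ α) (x v : ℝ) :
    min 1 (μ / 2) * (α * x ^ 2 + v ^ 2) ≤ modeLyapunov μ α x v := by
  have h₁ : min 1 (μ / 2) * (α * x ^ 2) ≤ 1 * (α * x ^ 2) := by
    gcongr
    exact min_le_left _ _
  have h₂ : min 1 (μ / 2) * v ^ 2 ≤ μ / 2 * v ^ 2 := by
    gcongr
    exact min_le_right _ _
  have hsq : modeLyapunov μ α x v = α * x ^ 2 + μ / 2 * v ^ 2 + μ / 2 * (v + x / μ) ^ 2 := by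
    unfold modeLyapunov
    field_simp
    ring
  have : 0 ≤ μ / 2 * (v + x / μ) ^ 2 := by positivity
  linarith

lemma modeLyapunov_le_energy {μ a₀ α : ℝ} (hμ : 0 < μ) (ha₀ : 0 < a₀) (hα : a₀ ≤ α) (x v : ℝ) :
    modeLyapunov μ α x v ≤ (3 * μ / 2 + 1 + 1 / (μ * a₀)) * (α * x ^ 2 + v ^ 2) := by
  have hα0 : 0 < α := ha₀.trans_le hα
  have hsq : modeLyapunov μ α x v =
      α * x ^ 2 + 3 * μ / 2 * v ^ 2 + 1 / μ * x ^ 2 - μ / 2 * (v - x / μ) ^ 2 := by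
    unfold modeLyapunov
    field_simp
    ring
  have hnn : 0 ≤ μ / 2 * (v - x / μ) ^ 2 := by positivity
  have hx : 1 / μ * x ^ 2 ≤ 1 / (μ * a₀) * (α * x ^ 2) := by
    have : 1 / (μ * a₀) * (a₀ * x ^ 2) = 1 / μ * x ^ 2 := by field_simp
    rw [← this]
    gcongr
  have h₁ : 0 ≤ 3 * μ / 2 * (α * x ^ 2) := by positivity
  have h₂ : 0 ≤ (1 + 1 / (μ * a₀)) * v ^ 2 := by positivity
  linarith

lemma IsModeSolution.hasDerivWithinAt_modeLyapunov {μ α : ℝ} {u u' u'' : ℝ → ℝ} (hμ : μ ≠ 0)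
    (h : IsModeSolution μ α u u' u'') {t : ℝ} (ht : t ∈ Ici (0 : ℝ)) :
    HasDerivWithinAt (fun s => modeLyapunov μ α (u s) (u' s))
      (-(u' t ^ 2 + α / μ * u t ^ 2)) (Ici 0) t := by
  have hu := h.1 t ht
  have hv := h.2.1 t ht
  have hode := h.2.2.2 t ht
  have hF := ((((hv.pow 2).const_mul μ).add ((hu.pow 2).const_mul α)).add (hu.mul hv)).add
    ((hu.pow 2).div_const (2 * μ))
  refine hF.congr_deriv ?_
  have hacc : u'' t = -(u' t + α * u t) / μ := by
    field_simp
    linarith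
  rw [hacc]
  field_simp
  ring

/-- A function with `f' ≤ -ω f` on `[0, ∞)` decays exponentially. -/
lemma le_exp_mul_of_hasDerivWithinAt_le {f f' : ℝ → ℝ} {ω : ℝ}
    (hf : ∀ t ∈ Ici (0 : ℝ), HasDerivWithinAt f (f' t) (Ici 0) t)
    (hle : ∀ t ∈ Ici (0 : ℝ), f' t ≤ -ω * f t) {t : ℝ} (ht : 0 ≤ t) :
    f t ≤ Real.exp (-ω * t) * f 0 := by
  have hg : ∀ s ∈ Ici (0 : ℝ), HasDerivWithinAt (fun s => Real.exp (ω * s) * f s)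
      (Real.exp (ω * s) * (ω * f s + f' s)) (Ici 0) s := fun s hs => by
    have he := ((hasDerivAt_id s).const_mul ω).exp.hasDerivWithinAt (s := Ici 0)
    refine (he.mul (hf s hs)).congr_deriv ?_
    simp only [id]
    ring
  have hanti : AntitoneOn (fun s => Real.exp (ω * s) * f s) (Ici 0) :=
    antitoneOn_of_hasDerivWithinAt_nonpos (convex_Ici 0)
      (fun s hs => (hg s hs).continuousWithinAt)
      (fun s hs => (hg s (interior_subset hs)).mono interior_subset)
      (fun s hs => mul_nonpos_of_nonneg_of_nonpos (Real.exp_pos _).le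
        (by linarith [hle s (interior_subset hs)]))
  have h0 : Real.exp (ω * t) * f t ≤ f 0 := by
    simpa using hanti self_mem_Ici (mem_Ici.2 ht) ht
  calc f t = Real.exp (-ω * t) * (Real.exp (ω * t) * f t) := by
        rw [← mul_assoc, ← Real.exp_add]
        simp
    _ ≤ Real.exp (-ω * t) * f 0 := by gcongr

/-- Uniform (in `α ≥ a₀`) exponential decay of the mode energy. -/
theorem mode_energy_exponential_decay (μ a₀ : ℝ) (hμ : 0 < μ) (ha₀ : 0 < a₀) :
    ∃ M > (0:ℝ), ∃ ω > (0:ℝ), ∀ α : ℝ, a₀ ≤ α →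
      ∀ u u' u'' : ℝ → ℝ, IsModeSolution μ α u u' u'' →
        ∀ t ≥ (0:ℝ),
          α * (u t) ^ 2 + (u' t) ^ 2 ≤
            M * Real.exp (-ω * t) * (α * (u 0) ^ 2 + (u' 0) ^ 2) := by
  set c : ℝ := min 1 (μ / 2)
  set C : ℝ := 3 * μ / 2 + 1 + 1 / (μ * a₀)
  set m : ℝ := min 1 (1 / μ)
  have hc : 0 < c := lt_min one_pos (by positivity)
  have hC : 0 < C := by positivity
  have hm : 0 < m := lt_min one_pos (by positivity)
  refine ⟨C / c, by positivity, m / C, by positivity, fun α hα u u' u'' h t ht => ?_⟩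
  have hα0 : 0 < α := ha₀.trans_le hα
  have hdecay := le_exp_mul_of_hasDerivWithinAt_le (ω := m / C)
    (fun s hs => h.hasDerivWithinAt_modeLyapunov hμ.ne' hs) (fun s _ => by
      have hup : m / C * modeLyapunov μ α (u s) (u' s) ≤ m * (α * u s ^ 2 + u' s ^ 2) := by
        rw [div_mul_eq_mul_div, div_le_iff₀ hC, mul_assoc, mul_comm _ C]
        exact mul_le_mul_of_nonneg_left (modeLyapunov_le_energy hμ ha₀ hα _ _) hm.le
      have h₁ : m * (α * u s ^ 2) ≤ 1 / μ * (α * u s ^ 2) := by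
        gcongr
        exact min_le_right _ _
      have h₂ : m * u' s ^ 2 ≤ 1 * u' s ^ 2 := by
        gcongr
        exact min_le_left _ _
      have h₃ : α / μ * u s ^ 2 = 1 / μ * (α * u s ^ 2) := by ring
      linarith) ht
  have hlow := energy_le_modeLyapunov hμ hα0.le (u t) (u' t)
  have hup : Real.exp (-(m / C) * t) * modeLyapunov μ α (u 0) (u' 0) ≤
      Real.exp (-(m / C) * t) * (C * (α * u 0 ^ 2 + u' 0 ^ 2)) := by
    gcongr
    exact modeLyapunov_le_energy hμ ha₀ hα _ _
  calc α * u t ^ 2 + u' t ^ 2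
      ≤ Real.exp (-(m / C) * t) * (C * (α * u 0 ^ 2 + u' 0 ^ 2)) / c := by
        rw [le_div_iff₀ hc, mul_comm]
        exact hlow.trans (hdecay.trans hup)
    _ = C / c * Real.exp (-(m / C) * t) * (α * u 0 ^ 2 + u' 0 ^ 2) := by ring
end

section
/- Let (α_k)_{k∈ℕ} be a nondecreasing sequence of positive real numbers tending to +∞. For μ > 0 and real sequences x = (x_k), y = (y_k), let u_k^μ denote the mode solution with parameters μ, α_k and initial data u_k^μ(0) = x_k, (u_k^μ)'(0) = y_k. Then for every T > 0, β > 0 and R > 0: the supremum over all t ∈ [0,T] and over all (x,y) satisfying (Σ_k α_k^β x_k²)^{1/2} + √μ·(Σ_k y_k²)^{1/2} ≤ R of the quantity (Σ_k (u_k^μ(t) − e^{−α_k t}·x_k)²)^{1/2} tends to 0 as μ → 0⁺. -/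
open MeasureTheory Set Filter

/-- A function on `[0,∞)` with nonpositive derivative is bounded by its initial value. -/
theorem le_initial_of_hasDerivWithinAt_nonpos {f f' : ℝ → ℝ}
    (hf : ∀ t ∈ Set.Ici (0:ℝ), HasDerivWithinAt f (f' t) (Set.Ici 0) t)
    (hf' : ∀ t ∈ Set.Ici (0:ℝ), f' t ≤ 0) {t : ℝ} (ht : 0 ≤ t) : f t ≤ f 0 := by
  have hanti : AntitoneOn f (Set.Ici 0) := by
    refine antitoneOn_of_hasDerivWithinAt_nonpos (f' := f') (convex_Ici 0)
      (fun s hs => (hf s hs).continuousWithinAt) (fun s hs => ?_) (fun s hs => ?_)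
    · exact (hf s (interior_subset hs)).mono interior_subset
    · exact hf' s (interior_subset hs)
  exact hanti Set.self_mem_Ici ht ht

namespace IsModeSolution

variable {μ α : ℝ} {u u' u'' : ℝ → ℝ}

theorem neg (h : IsModeSolution μ α u u' u'') :
    IsModeSolution μ α (fun t => -u t) (fun t => -u' t) (fun t => -u'' t) :=
  ⟨fun t ht => (h.1 t ht).fun_neg, fun t ht => (h.2.1 t ht).fun_neg, h.2.2.1.fun_neg,
    fun t ht => by linarith [h.2.2.2 t ht]⟩

/-- The energy of a mode solution does not exceed its initial value. -/
theorem energy_le (h : IsModeSolution μ α u u' u'') {t : ℝ} (ht : 0 ≤ t) :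
    α * u t ^ 2 + μ * u' t ^ 2 ≤ α * u 0 ^ 2 + μ * u' 0 ^ 2 := by
  obtain ⟨hu, hu', -, hode⟩ := h
  refine le_initial_of_hasDerivWithinAt_nonpos (f := fun t => α * u t ^ 2 + μ * u' t ^ 2)
    (f' := fun t => -2 * u' t ^ 2) (fun s hs => ?_)
    (fun s _ => by nlinarith [sq_nonneg (u' s)]) ht
  refine ((((hu s hs).fun_pow 2).const_mul α).fun_add
    (((hu' s hs).fun_pow 2).const_mul μ)).congr_deriv ?_
  have := hode s hs
  simp only [Nat.cast_ofNat, Nat.add_one_sub_one, pow_one]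
  linear_combination 2 * u' s * this

/-- One-sided comparison of `u + μ u'` with the heat mode. -/
theorem momentum_sub_heat_le (h : IsModeSolution μ α u u' u'') (hα : 0 ≤ α) {C : ℝ}
    (hC : ∀ t, 0 ≤ t → μ * u' t ≤ C) {t : ℝ} (ht : 0 ≤ t) :
    u t + μ * u' t - Real.exp (-α * t) * u 0 ≤ C := by
  obtain ⟨hu, hu', -, hode⟩ := h
  have hmono := le_initial_of_hasDerivWithinAt_nonpos
    (f := fun t => Real.exp (α * t) * (u t + μ * u' t - C))
    (f' := fun t => Real.exp (α * t) * (α * (μ * u' t - C))) (fun s hs => ?_)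
    (fun s hs => mul_nonpos_of_nonneg_of_nonpos (Real.exp_pos _).le
      (mul_nonpos_of_nonneg_of_nonpos hα (sub_nonpos.2 (hC s hs)))) ht
  · have h0 := hC 0 le_rfl
    simp only [mul_zero, Real.exp_zero, one_mul] at hmono
    have hexp : Real.exp (-α * t) * Real.exp (α * t) = 1 := by
      rw [← Real.exp_add]; simp
    have hle : Real.exp (α * t) * (u t + μ * u' t - C) ≤ u 0 := by linarith
    have := mul_le_mul_of_nonneg_left hle (Real.exp_pos (-α * t)).le
    rw [← mul_assoc, hexp] at this
    linarith
  · have hexp : HasDerivWithinAt (fun t => Real.exp (α * t)) (Real.exp (α * s) * α)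
        (Set.Ici 0) s := by
      simpa using (((hasDerivAt_id s).const_mul α).exp).hasDerivWithinAt
    refine (hexp.fun_mul (((hu s hs).fun_add ((hu' s hs).const_mul μ)).sub_const C)).congr_deriv ?_
    linear_combination Real.exp (α * s) * hode s hs

/-- Error bound for modes of low frequency. -/
theorem sub_heat_sq_le_low (h : IsModeSolution μ α u u' u'') (hμ : 0 < μ) (hα : 0 < α)
    {t : ℝ} (ht : 0 ≤ t) :
    (u t - Real.exp (-α * t) * u 0) ^ 2 ≤ 4 * μ * (α * u 0 ^ 2 + μ * u' 0 ^ 2) := by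
  set E := α * u 0 ^ 2 + μ * u' 0 ^ 2
  have hE : 0 ≤ μ * E := by positivity
  have hv : ∀ s, 0 ≤ s → |μ * u' s| ≤ √(μ * E) := fun s hs => by
    refine Real.abs_le_sqrt ?_
    have : μ * u' s ^ 2 ≤ E := by nlinarith [h.energy_le hs, sq_nonneg (u s)]
    nlinarith
  have hup := h.momentum_sub_heat_le hα.le (fun s hs => (abs_le.1 (hv s hs)).2) ht
  have hlo := h.neg.momentum_sub_heat_le (C := √(μ * E)) hα.le
    (fun s hs => by linarith [(abs_le.1 (hv s hs)).1]) ht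
  obtain ⟨h1, h2⟩ := abs_le.1 (hv t ht)
  have habs : |u t - Real.exp (-α * t) * u 0| ≤ 2 * √(μ * E) :=
    abs_le.2 ⟨by linarith, by linarith⟩
  calc (u t - Real.exp (-α * t) * u 0) ^ 2 ≤ (2 * √(μ * E)) ^ 2 := sq_le_sq' (abs_le.1 habs).1
        (abs_le.1 habs).2
    _ = 4 * μ * E := by rw [mul_pow, Real.sq_sqrt hE]; ring

/-- Error bound for modes of high frequency. -/
theorem sub_heat_sq_le_high (h : IsModeSolution μ α u u' u'') (hμ : 0 < μ) (hα : 0 < α)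
    {t : ℝ} (ht : 0 ≤ t) :
    (u t - Real.exp (-α * t) * u 0) ^ 2 ≤ 4 * u 0 ^ 2 + 2 / α * (μ * u' 0 ^ 2) := by
  have hu : u t ^ 2 ≤ u 0 ^ 2 + μ * u' 0 ^ 2 / α := by
    rw [← sub_le_iff_le_add', le_div_iff₀ hα]
    nlinarith [h.energy_le ht, mul_nonneg hμ.le (sq_nonneg (u' t))]
  have hexp : (Real.exp (-α * t) * u 0) ^ 2 ≤ u 0 ^ 2 := by
    rw [mul_pow]
    refine mul_le_of_le_one_left (sq_nonneg _) (pow_le_one₀ (Real.exp_pos _).le ?_)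
    exact Real.exp_le_one_iff.2 (by nlinarith)
  have hdiv : 2 / α * (μ * u' 0 ^ 2) = 2 * (μ * u' 0 ^ 2 / α) := by ring
  nlinarith [sq_nonneg (u t + Real.exp (-α * t) * u 0)]

end IsModeSolution

/-- The mode error is small relative to the `H^β` energy of the data, uniformly over all
frequencies bounded below. -/
theorem exists_forall_isModeSolution_sub_heat_sq_le {a β δ : ℝ} (ha : 0 < a) (hβ : 0 < β)
    (hδ : 0 < δ) : ∃ μ₀ > (0:ℝ), ∀ μ α : ℝ, 0 < μ → μ ≤ μ₀ → a ≤ α →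
      ∀ u u' u'' : ℝ → ℝ, IsModeSolution μ α u u' u'' → ∀ t : ℝ, 0 ≤ t →
        (u t - Real.exp (-α * t) * u 0) ^ 2 ≤
          δ * (α ^ β * u 0 ^ 2 + μ * u' 0 ^ 2) := by
  obtain ⟨N, hN0, hNβ, hN⟩ : ∃ N : ℝ, 0 < N ∧ 4 / δ ≤ N ^ β ∧ 2 / δ ≤ N :=
    ((eventually_gt_atTop 0).and (((tendsto_rpow_atTop hβ).eventually_ge_atTop _).and
      (eventually_ge_atTop _))).exists
  have haβ : 0 < a ^ β := Real.rpow_pos_of_pos ha β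
  refine ⟨min (δ / 4) (δ * a ^ β / (4 * N)), by positivity, ?_⟩
  intro μ α hμ hμ₀ haα u u' u'' h t ht
  have hα : 0 < α := ha.trans_le haα
  have hy : 0 ≤ μ * u' 0 ^ 2 := by positivity
  rcases le_total α N with hαN | hαN
  · have h1 : 4 * μ ≤ δ := by linarith [hμ₀.trans (min_le_left _ _)]
    have h2 : 4 * μ * α ≤ δ * α ^ β := by
      have h3 := hμ₀.trans (min_le_right _ _)
      rw [le_div_iff₀ (by positivity)] at h3
      have h4 : a ^ β ≤ α ^ β := Real.rpow_le_rpow ha.le haα hβ.le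
      calc 4 * μ * α ≤ 4 * μ * N := by gcongr
        _ ≤ δ * a ^ β := by linarith
        _ ≤ δ * α ^ β := by gcongr
    nlinarith [h.sub_heat_sq_le_low hμ hα ht, mul_le_mul_of_nonneg_right h1 hy,
      mul_le_mul_of_nonneg_right h2 (sq_nonneg (u 0))]
  · have h1 : 4 ≤ δ * α ^ β := by
      rw [← div_le_iff₀' hδ]
      exact hNβ.trans (Real.rpow_le_rpow hN0.le hαN hβ.le)
    have h2 : 2 / α ≤ δ := (div_le_comm₀ hα hδ).2 (hN.trans hαN)
    nlinarith [h.sub_heat_sq_le_high hμ hα ht, mul_le_mul_of_nonneg_right h2 hy,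
      mul_le_mul_of_nonneg_right h1 (sq_nonneg (u 0))]

/-- Spectral form of `lim_{μ→0} sup_{|x|_{H^β} + √μ|y|_H ≤ R} sup_{t ≤ T}
`|Π₁S_μ(t)(x,y) − S(t)x|_{L²} = 0`. -/
theorem smu_to_heat_uniform_on_bounded_sets
    (α : ℕ → ℝ) (hpos : ∀ k, 0 < α k) (hmono : Monotone α)
    (hdiv : Tendsto α atTop atTop)
    (T β R : ℝ) (hT : 0 < T) (hβ : 0 < β) (hR : 0 < R) :
    ∀ ε > (0:ℝ), ∃ μ₀ > (0:ℝ), ∀ μ : ℝ, 0 < μ → μ ≤ μ₀ →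
      ∀ (x y : ℕ → ℝ) (u u' u'' : ℕ → ℝ → ℝ),
        (∀ k, IsModeSolution μ (α k) (u k) (u' k) (u'' k)) →
        (∀ k, u k 0 = x k) → (∀ k, u' k 0 = y k) →
        Summable (fun k => α k ^ β * (x k) ^ 2) →
        Summable (fun k => (y k) ^ 2) →
        Real.sqrt (∑' k, α k ^ β * (x k) ^ 2) +
            Real.sqrt μ * Real.sqrt (∑' k, (y k) ^ 2) ≤ R →
        ∀ t ∈ Set.Icc (0:ℝ) T,
          Real.sqrt (∑' k, (u k t - Real.exp (-(α k) * t) * x k) ^ 2) ≤ ε := by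
  intro ε hε
  obtain ⟨μ₀, hμ₀, hmode⟩ :=
    exists_forall_isModeSolution_sub_heat_sq_le (hpos 0) hβ (δ := ε ^ 2 / R ^ 2) (by positivity)
  refine ⟨μ₀, hμ₀, fun μ hμ hμle x y u u' u'' hsol hx hy hsx hsy hbound t ht => ?_⟩
  set A := ∑' k, α k ^ β * (x k) ^ 2
  set B := ∑' k, (y k) ^ 2
  have hA : 0 ≤ A := tsum_nonneg fun k =>
    mul_nonneg (Real.rpow_nonneg (hpos k).le β) (sq_nonneg _)
  have hB : 0 ≤ B := tsum_nonneg fun k => sq_nonneg _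
  have hle : ∀ k, (u k t - Real.exp (-(α k) * t) * x k) ^ 2 ≤
      ε ^ 2 / R ^ 2 * (α k ^ β * (x k) ^ 2 + μ * (y k) ^ 2) := fun k => by
    rw [← hx k, ← hy k]
    exact hmode μ (α k) hμ hμle (hmono (Nat.zero_le k)) _ _ _ (hsol k) t ht.1
  have hdata : HasSum (fun k => ε ^ 2 / R ^ 2 * (α k ^ β * (x k) ^ 2 + μ * (y k) ^ 2))
      (ε ^ 2 / R ^ 2 * (A + μ * B)) := (hsx.hasSum.add (hsy.hasSum.mul_left μ)).mul_left _
  have hAB : A + μ * B ≤ R ^ 2 := by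
    have hsq := pow_le_pow_left₀ (by positivity) hbound 2
    have hcross : 0 ≤ √A * (√μ * √B) := by positivity
    have hexpand : (√A + √μ * √B) ^ 2 = A + μ * B + 2 * (√A * (√μ * √B)) := by
      rw [add_sq, mul_pow, Real.sq_sqrt hA, Real.sq_sqrt hμ.le, Real.sq_sqrt hB]; ring
    linarith
  refine Real.sqrt_le_iff.2 ⟨hε.le, ?_⟩
  calc ∑' k, (u k t - Real.exp (-(α k) * t) * x k) ^ 2
      ≤ ε ^ 2 / R ^ 2 * (A + μ * B) :=
        ((Summable.of_nonneg_of_le (fun k => sq_nonneg _) hle hdata.summable).tsum_le_tsum hle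
          hdata.summable).trans_eq hdata.tsum_eq
    _ ≤ ε ^ 2 / R ^ 2 * R ^ 2 := by gcongr
    _ = ε ^ 2 := by field_simp
end
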